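/- arXiv:1711.05832 — 2 statements merged into one kernel-verified Lean document; each statement's English description precedes it below -/
import Mathlib

section
/- Let p be a prime, G a finite p-group, H a subgroup of G, and i a natural number with i at most the p-rank of G. Suppose H is i-trivial in G, and suppose (p−1)·r(H) + i > r(G) + 2, where r(H) and r(G) denote the p-ranks of H and G. Then H^p is ((p−1)·r(H) + i)-trivial in G ≀ Z/p; that is, for every elementary abelian p-subgroup E of G ≀ Z/p with rank at least (p−1)·r(H) + i, the centralizer of E in G ≀ Z/p is contained in the subgroup H^p of the base subgroup. -/
/-- The shift automorphism of the direct power `ZMod p → H` by `k : ZMod p`. -/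
def shiftAut (p : ℕ) (H : Type*) [Group H] (k : ZMod p) : MulAut (ZMod p → H) where
  toFun f := fun i => f (i + k)
  invFun f := fun i => f (i - k)
  left_inv f := by funext i; simp
  right_inv f := by funext i; simp
  map_mul' f g := rfl

/-- The shift action of `ZMod p` on the direct power `ZMod p → H`. -/
def shiftHom (p : ℕ) (H : Type*) [Group H] :
    Multiplicative (ZMod p) →* MulAut (ZMod p → H) where
  toFun k := shiftAut p H k.toAdd
  map_one' := by
    ext f i
    show f (i + Multiplicative.toAdd 1) = f i
    simp
  map_mul' a b := by
    ext f i
    show f (i + Multiplicative.toAdd (a * b)) = f (i + Multiplicative.toAdd a + Multiplicative.toAdd b)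
    rw [toAdd_mul, add_assoc]

/-- The wreath product `H ≀ ℤ/p`. -/
abbrev WreathZp (p : ℕ) (H : Type*) [Group H] : Type _ :=
  SemidirectProduct (ZMod p → H) (Multiplicative (ZMod p)) (shiftHom p H)

/-- The inclusion of the base subgroup `H^p` into the wreath product. -/
abbrev wreathInl (p : ℕ) (H : Type*) [Group H] : (ZMod p → H) →* WreathZp p H :=
  SemidirectProduct.inl

/-- The base subgroup `H^p` of the wreath product, i.e. the elements with trivial
`ZMod p` component. -/
def wreathBase (p : ℕ) (H : Type*) [Group H] : Subgroup (WreathZp p H) :=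
  (wreathInl p H).range

/-- `E` is an elementary abelian `p`-subgroup (a `p`-torus) of rank `r`, i.e. `E` is
isomorphic to `(ZMod p)^r`. -/
def IsPTorus (p : ℕ) {G : Type*} [Group G] (E : Subgroup G) (r : ℕ) : Prop :=
  Nonempty (E ≃* (Fin r → Multiplicative (ZMod p)))

/-- The `p`-rank of a group: the maximal rank of an elementary abelian `p`-subgroup. -/
noncomputable def pRank (p : ℕ) (G : Type*) [Group G] : ℕ :=
  sSup {r | ∃ E : Subgroup G, IsPTorus p E r}


/-- A subgroup `H` of `G` is `i`-trivial if the centralizer of every elementary abelian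
`p`-subgroup of rank at least `i` is contained in `H`. -/
def ITrivial (p : ℕ) {G : Type*} [Group G] (H : Subgroup G) (i : ℕ) : Prop :=
  ∀ (E : Subgroup G) (r : ℕ), i ≤ r → IsPTorus p E r →
    Subgroup.centralizer (E : Set G) ≤ H

/-- For a subgroup `K ≤ H`, the subgroup `K^p = (ZMod p → K)` of the base subgroup of
the wreath product `H ≀ ℤ/p`. -/
def wreathBasePow (p : ℕ) {H : Type*} [Group H] (K : Subgroup H) :
    Subgroup (WreathZp p H) :=
  (Subgroup.pi (Set.univ : Set (ZMod p)) fun _ => K).map (wreathInl p H)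

/-- Commutative of exponent dividing `p`. -/
def ElemAb (p : ℕ) {G : Type*} [Group G] (E : Subgroup G) : Prop :=
  (∀ x ∈ E, ∀ y ∈ E, x * y = y * x) ∧ ∀ x ∈ E, x ^ p = 1

theorem IsPTorus.elemAb {p : ℕ} {G : Type*} [Group G] {E : Subgroup G} {r : ℕ}
    (h : IsPTorus p E r) : ElemAb p E := by
  obtain ⟨e⟩ := h
  constructor
  · intro x hx y hy
    have : (⟨x, hx⟩ : E) * ⟨y, hy⟩ = ⟨y, hy⟩ * ⟨x, hx⟩ := by
      apply e.injective
      rw [map_mul, map_mul, mul_comm]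
    exact congrArg Subtype.val this
  · intro x hx
    have : (⟨x, hx⟩ : E) ^ p = 1 := by
      apply e.injective
      rw [map_pow, map_one]
      funext j
      apply Multiplicative.toAdd.injective
      simp
    exact congrArg Subtype.val this

theorem IsPTorus.card {p : ℕ} {G : Type*} [Group G] {E : Subgroup G} {r : ℕ}
    (h : IsPTorus p E r) : Nat.card E = p ^ r := by
  obtain ⟨e⟩ := h
  rw [Nat.card_congr e.toEquiv, Nat.card_fun]
  have : Nat.card (Multiplicative (ZMod p)) = p := by
    rw [Nat.card_congr Multiplicative.toAdd, Nat.card_zmod]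
  rw [this]; simp

theorem exists_addEquiv_pi (K V : Type*) [Field K] [AddCommGroup V] [Module K V] [Finite V] :
    ∃ r, Nonempty (V ≃+ (Fin r → K)) := by
  have : Module.Finite K V := Module.Finite.of_finite
  exact ⟨_, ⟨(Module.finBasis K V).equivFun.toAddEquiv⟩⟩

theorem exists_equiv_pi {p : ℕ} (hp : p.Prime) (A : Type*) [CommGroup A] [Finite A]
    (h : ∀ x : A, x ^ p = 1) : ∃ r, Nonempty (A ≃* (Fin r → Multiplicative (ZMod p))) := by
  haveI := Fact.mk hp
  letI : Module (ZMod p) (Additive A) := AddCommGroup.zmodModule (n := p) (by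
    intro x
    apply Additive.toMul.injective
    exact h _)
  obtain ⟨r, ⟨e⟩⟩ := exists_addEquiv_pi (ZMod p) (Additive A)
  refine ⟨r, ⟨?_⟩⟩
  exact
    { toFun := fun x j => Multiplicative.ofAdd (e (Additive.ofMul x) j)
      invFun := fun f => (e.symm (fun j => (f j).toAdd)).toMul
      left_inv := fun x => by simp
      right_inv := fun f => by simp
      map_mul' := fun x y => by
        funext j
        have : e (Additive.ofMul (x * y)) = e (Additive.ofMul x) + e (Additive.ofMul y) := by
          rw [← map_add]; rfl
        show Multiplicative.ofAdd (e (Additive.ofMul (x * y)) j) = _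
        rw [this]; rfl }

theorem ElemAb.exists_torus {p : ℕ} (hp : p.Prime) {G : Type*} [Group G] [Finite G]
    {E : Subgroup G} (h : ElemAb p E) : ∃ r, IsPTorus p E r := by
  letI : CommGroup E := { (inferInstance : Group E) with
    mul_comm := fun x y => Subtype.ext (h.1 x x.2 y y.2) }
  exact exists_equiv_pi hp E (fun x => Subtype.ext (h.2 _ x.2))

theorem pRank_bdd {p : ℕ} (hp : p.Prime) (G : Type*) [Group G] [Finite G] :
    BddAbove {r | ∃ E : Subgroup G, IsPTorus p E r} := by
  refine ⟨Nat.card G, ?_⟩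
  rintro r ⟨E, hE⟩
  have h1 := hE.card
  have h2 : Nat.card E ≤ Nat.card G := Subgroup.card_le_card_group E
  have h3 : r < p ^ r := Nat.lt_pow_self hp.one_lt
  omega

theorem IsPTorus.le_pRank {p : ℕ} (hp : p.Prime) {G : Type*} [Group G] [Finite G]
    {E : Subgroup G} {r : ℕ} (h : IsPTorus p E r) : r ≤ pRank p G :=
  le_csSup (pRank_bdd hp G) ⟨E, h⟩

theorem exists_pRank {p : ℕ} (hp : p.Prime) (G : Type*) [Group G] [Finite G] :
    ∃ E : Subgroup G, IsPTorus p E (pRank p G) := by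
  refine Nat.sSup_mem ?_ (pRank_bdd hp G)
  obtain ⟨r, hr⟩ := ElemAb.exists_torus hp (G := G) (E := ⊥) (by
    constructor
    · intro x hx y hy
      rw [Subgroup.mem_bot] at hx hy
      rw [hx, hy]
    · intro x hx
      rw [Subgroup.mem_bot] at hx
      rw [hx, one_pow])
  exact ⟨r, ⊥, hr⟩

theorem ElemAb.map {p : ℕ} {G K : Type*} [Group G] [Group K] {E : Subgroup G}
    (h : ElemAb p E) (φ : G →* K) : ElemAb p (E.map φ) := by
  constructor
  · rintro _ ⟨x, hx, rfl⟩ _ ⟨y, hy, rfl⟩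
    rw [← map_mul, ← map_mul, h.1 x hx y hy]
  · rintro _ ⟨x, hx, rfl⟩
    rw [← map_pow, h.2 x hx, map_one]

theorem ElemAb.card_le {p : ℕ} (hp : p.Prime) {G : Type*} [Group G] [Finite G]
    {E : Subgroup G} (h : ElemAb p E) : Nat.card E ≤ p ^ pRank p G := by
  obtain ⟨r, hr⟩ := h.exists_torus hp
  rw [hr.card]
  exact Nat.pow_le_pow_right hp.pos (hr.le_pRank hp)

theorem ElemAb.comap {p : ℕ} {G : Type*} [Group G] {E : Subgroup (WreathZp p G)}
    (h : ElemAb p E) : ElemAb p (E.comap (wreathInl p G)) := by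
  constructor
  · intro x hx y hy
    apply SemidirectProduct.inl_injective (φ := shiftHom p G)
    rw [map_mul, map_mul]
    exact h.1 _ hx _ hy
  · intro x hx
    apply SemidirectProduct.inl_injective (φ := shiftHom p G)
    rw [map_pow, map_one]
    exact h.2 _ hx

theorem eq_one_of_commute {p : ℕ} (hp : p.Prime) {G : Type*} [Group G]
    (x : WreathZp p G) (hx : x.right ≠ 1) (f : ZMod p → G)
    (hf : x * wreathInl p G f = wreathInl p G f * x) (h0 : f 0 = 1) : f = 1 := by
  haveI := Fact.mk hp
  have hk : x.right.toAdd ≠ 0 := fun h => hx (Multiplicative.toAdd.injective h)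
  have key : ∀ j, x.left j * f (j + x.right.toAdd) = f j * x.left j := by
    intro j
    have := congrFun (congrArg SemidirectProduct.left hf) j
    simpa [SemidirectProduct.mul_left, shiftHom, shiftAut] using this
  have hn : ∀ n : ℕ, f (n * x.right.toAdd) = 1 := by
    intro n
    induction n with
    | zero => simpa using h0
    | succ n ih =>
      have := key (n * x.right.toAdd)
      rw [ih, one_mul] at this
      have h2 := mul_eq_left.mp this
      rw [← h2]; congr 1; push_cast; ring
  funext j
  have := hn (j / x.right.toAdd).val
  rwa [ZMod.natCast_zmod_val, div_mul_cancel₀ _ hk] at this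

theorem card_le_of_commute {p : ℕ} (hp : p.Prime) {G : Type*} [Group G] [Finite G]
    (x : WreathZp p G) (hx : x.right ≠ 1) (F : Subgroup (ZMod p → G)) (hF : ElemAb p F)
    (hc : ∀ f ∈ F, x * wreathInl p G f = wreathInl p G f * x) :
    Nat.card F ≤ p ^ pRank p G := by
  refine le_trans ?_ ((hF.map (Pi.evalMonoidHom (fun _ : ZMod p => G) 0)).card_le hp)
  refine Nat.card_le_card_of_injective
    (fun f : F => (⟨f.1 0, ⟨f.1, f.2, rfl⟩⟩ : F.map (Pi.evalMonoidHom (fun _ : ZMod p => G) 0))) ?_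
  intro a b hab
  have hab' : a.1 0 = b.1 0 := congrArg Subtype.val hab
  have := eq_one_of_commute hp x hx (a.1 * b.1⁻¹) (hc _ (F.mul_mem a.2 (F.inv_mem b.2)))
    (by simp [hab'])
  exact Subtype.ext (mul_inv_eq_one.mp this)

theorem card_le_comap {p : ℕ} (hp : p.Prime) {G : Type*} [Group G] [Finite G]
    (E : Subgroup (WreathZp p G)) :
    Nat.card E ≤ Nat.card (E.comap (wreathInl p G)) * p := by
  haveI := Fact.mk hp
  have h1 := Subgroup.card_mul_index
    ((SemidirectProduct.rightHom.comp E.subtype : E →* Multiplicative (ZMod p)).ker)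
  rw [Subgroup.index_ker] at h1
  rw [← h1]
  refine Nat.mul_le_mul ?_ ?_
  · refine Nat.card_le_card_of_injective (fun x => ⟨x.1.1.left, ?_⟩) ?_
    · have h2 : x.1.1.right = 1 := x.2
      have : wreathInl p G x.1.1.left = x.1.1 := by
        apply SemidirectProduct.ext
        · simp
        · simp [h2]
      show wreathInl p G x.1.1.left ∈ E
      rw [this]
      exact x.1.2
    · intro a b hab
      have h2 : a.1.1.right = 1 := a.2
      have h3 : b.1.1.right = 1 := b.2
      apply Subtype.ext
      apply Subtype.ext
      exact SemidirectProduct.ext (congrArg Subtype.val hab) (h2.trans h3.symm)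
  · refine (Subgroup.card_le_card_group _).trans ?_
    rw [Nat.card_congr Multiplicative.toAdd, Nat.card_zmod]

theorem pRank_le_of_trivial {p : ℕ} (hp : p.Prime) {G : Type*} [Group G] [Finite G]
    (H : Subgroup G) (i : ℕ) (hi : i ≤ pRank p G) (htriv : ITrivial p H i) :
    pRank p G ≤ pRank p H := by
  obtain ⟨E, hE⟩ := exists_pRank hp G
  have hEH : E ≤ H := by
    refine le_trans ?_ (htriv E _ hi hE)
    intro x hx
    rw [Subgroup.mem_centralizer_iff]
    intro y hy
    exact hE.elemAb.1 y hy x hx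
  obtain ⟨e⟩ := hE
  exact IsPTorus.le_pRank hp (E := E.subgroupOf H)
    ⟨(Subgroup.subgroupOfEquivOfLe hEH).trans e⟩

/-- if `G` is a finite `p`-group, `H ≤ G` is `i`-trivial with
`i ≤ pRank p G` and `(p-1)·pRank p H + i > pRank p G + 2`, then `H^p` is
`((p-1)·pRank p H + i)`-trivial in `G ≀ ℤ/p`. -/
theorem stmt5 (p : ℕ) (hp : p.Prime) (G : Type*) [Group G] [Finite G]
    (hpG : IsPGroup p G) (H : Subgroup G) (i : ℕ)
    (hi : i ≤ pRank p G) (htriv : ITrivial p H i)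
    (hbig : pRank p G + 2 < (p - 1) * pRank p ↥H + i) :
    ITrivial p (wreathBasePow p H) ((p - 1) * pRank p ↥H + i) := by
  intro E r hr hE x hx
  haveI := Fact.mk hp
  have hcard := hE.card
  have hEA := hE.elemAb
  have hF := hEA.comap
  have hle := card_le_comap hp E
  have hRH := pRank_le_of_trivial hp H i hi htriv
  rw [Subgroup.mem_centralizer_iff] at hx
  have hno : ∀ y : WreathZp p G, (∀ z ∈ E, z * y = y * z) → y.right = 1 := by
    intro y hy
    by_contra hne
    have h1 := card_le_of_commute hp y hne _ hF (fun f hf => (hy _ hf).symm)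
    have h2 : p ^ r ≤ p ^ (pRank p G + 1) := by
      rw [← hcard, pow_succ]
      exact hle.trans (Nat.mul_le_mul_right _ h1)
    have := (Nat.pow_le_pow_iff_right hp.one_lt).mp h2
    omega
  have hright : ∀ y : WreathZp p G, y.right = 1 → wreathInl p G y.left = y := by
    intro y hy
    apply SemidirectProduct.ext
    · simp
    · simp [hy]
  have hxr := hno x hx
  have hEr : ∀ y ∈ E, y.right = 1 := fun y hy => hno y (fun z hz => hEA.1 z hz y hy)
  refine ⟨x.left, ?_, hright x hxr⟩
  rw [SetLike.mem_coe, Subgroup.mem_pi]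
  intro j _
  let T : ZMod p → Subgroup G := fun k =>
    (E.comap (wreathInl p G)).map (Pi.evalMonoidHom (fun _ : ZMod p => G) k)
  have hT : ∀ k, ElemAb p (T k) := fun k => hF.map _
  obtain ⟨s, hs⟩ := (hT j).exists_torus hp
  have hprod : Nat.card E ≤ ∏ k, Nat.card (T k) := by
    rw [← Nat.card_pi]
    refine Nat.card_le_card_of_injective (fun y k => ⟨y.1.left k, ⟨y.1.left, ?_, rfl⟩⟩) ?_
    · show wreathInl p G y.1.left ∈ E
      rw [hright _ (hEr _ y.2)]
      exact y.2
    · intro a b hab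
      apply Subtype.ext
      refine SemidirectProduct.ext ?_ ((hEr _ a.2).trans (hEr _ b.2).symm)
      funext k
      exact congrArg Subtype.val (congrFun hab k)
  have hle2 : p ^ r ≤ p ^ (s + (p - 1) * pRank p G) := by
    rw [← hcard]
    refine hprod.trans ?_
    rw [← Finset.mul_prod_erase Finset.univ _ (Finset.mem_univ j), hs.card, pow_add]
    refine Nat.mul_le_mul_left _ ?_
    refine (Finset.prod_le_pow_card _ _ (p ^ pRank p G) (fun k _ => (hT k).card_le hp)).trans ?_
    rw [Finset.card_erase_of_mem (Finset.mem_univ j), Finset.card_univ, ZMod.card, ← pow_mul,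
      mul_comm]
  have hle3 := (Nat.pow_le_pow_iff_right hp.one_lt).mp hle2
  have hmul := Nat.mul_le_mul_left (p - 1) hRH
  refine htriv (T j) s (by omega) hs ?_
  rw [Subgroup.mem_centralizer_iff]
  rintro _ ⟨f, hf, rfl⟩
  have h1 := hx _ hf
  rw [← hright x hxr, ← map_mul, ← map_mul] at h1
  exact congrFun (SemidirectProduct.inl_injective h1) j
end

section
/- Let p be a prime, G a finite group, H a subgroup of G, and i a natural number with i at most the p-rank of G. Suppose that for every elementary abelian p-subgroup E of G with rank at least i, the centralizer C_G(E) is contained in H (i.e. H is i-trivial in G). Then the p-rank of H equals the p-rank of G. -/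
theorem pTorus_set_bdd (p : ℕ) (hp : p.Prime) (G : Type*) [Group G] [Finite G] :
    BddAbove {r | ∃ E : Subgroup G, IsPTorus p E r} := by
  refine ⟨Nat.card G, ?_⟩
  rintro r ⟨E, ⟨e⟩⟩
  have h1 : Nat.card E = p ^ r := by
    rw [Nat.card_congr e.toEquiv, Nat.card_fun]
    simp [Nat.card_congr (Multiplicative.toAdd (α := ZMod p)), Nat.card_zmod]
  have h2 : Nat.card E ≤ Nat.card G := Subgroup.card_le_card_group E
  have h3 : r < p ^ r := Nat.lt_pow_self hp.one_lt
  omega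

theorem pTorus_set_nonempty (p : ℕ) (G : Type*) [Group G] :
    {r | ∃ E : Subgroup G, IsPTorus p E r}.Nonempty :=
  ⟨0, ⊥, ⟨MulEquiv.ofUnique⟩⟩

/-- if `H` is an `i`-trivial subgroup of the finite group `G` with
`i` at most the `p`-rank of `G`, then the `p`-rank of `H` equals the `p`-rank of `G`. -/
theorem stmt14 (p : ℕ) (hp : p.Prime) (G : Type*) [Group G] [Finite G]
    (H : Subgroup G) (i : ℕ) (hi : i ≤ pRank p G) (htriv : ITrivial p H i) :
    pRank p ↥H = pRank p G := by
  apply le_antisymm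
  · apply csSup_le (pTorus_set_nonempty p H)
    rintro r ⟨E, ⟨e⟩⟩
    refine le_csSup (pTorus_set_bdd p hp G) ⟨E.map H.subtype, ⟨?_⟩⟩
    exact (E.equivMapOfInjective H.subtype H.subtype_injective).symm.trans e
  · obtain ⟨E, ⟨e⟩⟩ := Nat.sSup_mem (pTorus_set_nonempty p G) (pTorus_set_bdd p hp G)
    have hE : E ≤ H := by
      refine le_trans ?_ (htriv E _ hi ⟨e⟩)
      intro x hx
      rw [Subgroup.mem_centralizer_iff]
      intro y hy
      have : (⟨y, hy⟩ * ⟨x, hx⟩ : E) = ⟨x, hx⟩ * ⟨y, hy⟩ := by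
        apply e.injective
        rw [map_mul, map_mul, mul_comm]
      exact congrArg Subtype.val this
    exact le_csSup (pTorus_set_bdd p hp H)
      ⟨E.subgroupOf H, ⟨(Subgroup.subgroupOfEquivOfLe hE).trans e⟩⟩
end
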